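/- For every smooth function f : ℝ^n → ℂ one has |f(0)| ≤ ∑_{I ⊆ {1,…,n}} ∫_{[0,1]^n} |∂^I f / ∏_{i∈I} ∂x_i (x)| dx, where the sum is over all subsets I of {1,…,n} and ∂^I denotes the corresponding iterated partial derivative (the empty set giving f itself). -/

import Mathlib

open MeasureTheory

/-- For a finite set `s ⊆ {0,…,n-1}`, the iterated partial derivative
`∂^s f = ∏_{i ∈ s} ∂/∂x_i f`. -/
noncomputable def partialDerivSet {n : ℕ} (s : Finset (Fin n)) (f : (Fin n → ℝ) → ℂ) :
    (Fin n → ℝ) → ℂ :=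
  (s.sort (· ≤ ·)).foldr (fun i g => fun x => fderiv ℝ g x (Pi.single i 1)) f

/-- Iterated partial derivative along a list. -/
noncomputable def pdList {n : ℕ} (l : List (Fin n)) (f : (Fin n → ℝ) → ℂ) :
    (Fin n → ℝ) → ℂ :=
  l.foldr (fun i g => fun x => fderiv ℝ g x (Pi.single i 1)) f

theorem pdList_contDiff {n : ℕ} (l : List (Fin n)) (f : (Fin n → ℝ) → ℂ)
    (hf : ContDiff ℝ (⊤ : ℕ∞) f) : ContDiff ℝ (⊤ : ℕ∞) (pdList l f) := by
  induction l with
  | nil => exact hf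
  | cons i l ih =>
    change ContDiff ℝ (⊤ : ℕ∞) (fun x => fderiv ℝ (pdList l f) x (Pi.single i 1))
    exact (ih.fderiv_right (m := (⊤ : ℕ∞)) (by simp)).clm_apply contDiff_const

theorem contDiff_consv {n : ℕ} (u : ℝ) :
    ContDiff ℝ (⊤ : ℕ∞) (fun y : Fin n → ℝ => (Fin.cons u y : Fin (n+1) → ℝ)) := by
  rw [contDiff_pi]
  intro i
  refine Fin.cases ?_ (fun j => ?_) i
  · simpa using contDiff_const
  · simpa using contDiff_apply ℝ ℝ j

theorem pdList_cons {n : ℕ} (l : List (Fin n)) (f : (Fin (n+1) → ℝ) → ℂ)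
    (hf : ContDiff ℝ (⊤ : ℕ∞) f) (u : ℝ) (y : Fin n → ℝ) :
    pdList l (fun y => f (Fin.cons u y)) y = pdList (l.map Fin.succ) f (Fin.cons u y) := by
  induction l generalizing y with
  | nil => rfl
  | cons i l ih =>
    change fderiv ℝ (pdList l (fun y => f (Fin.cons u y))) y (Pi.single i 1) =
      fderiv ℝ (pdList (l.map Fin.succ) f) (Fin.cons u y) (Pi.single i.succ 1)
    have h1 := pdList_contDiff l (fun y => f (Fin.cons u y)) (hf.comp (contDiff_consv u))
    have h2 := pdList_contDiff (l.map Fin.succ) _ hf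
    rw [← ((h1.differentiable (by simp)) y).lineDeriv_eq_fderiv,
      ← ((h2.differentiable (by simp)) _).lineDeriv_eq_fderiv]
    unfold lineDeriv
    congr 1
    ext t
    refine (ih _).trans ?_
    congr 1
    ext j
    refine Fin.cases ?_ (fun j => ?_) j
    · simp
    · simp [Pi.single_apply]

theorem sum_finset_succ {n : ℕ} (F : Finset (Fin (n+1)) → ℝ) :
    ∑ s, F s = ∑ t : Finset (Fin n),
      (F (t.map (Fin.succEmb n)) + F (insert 0 (t.map (Fin.succEmb n)))) := by
  have h0 : (0 : Fin (n+1)) ∉ (Finset.univ : Finset (Fin n)).map (Fin.succEmb n) := by simp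
  have key : ∀ G : Finset (Fin (n+1)) → ℝ,
      ∑ s ∈ ((Finset.univ : Finset (Fin n)).map (Fin.succEmb n)).powerset, G s =
      ∑ t : Finset (Fin n), G (t.map (Fin.succEmb n)) := by
    intro G
    symm
    refine Finset.sum_bij (fun t _ => t.map (Fin.succEmb n)) ?_ ?_ ?_ ?_
    · intro t _
      simp only [Finset.mem_powerset]
      exact Finset.map_subset_map.2 (Finset.subset_univ _)
    · intro a _ b _ h
      exact Finset.map_injective _ h
    · intro b hb
      obtain ⟨t, -, rfl⟩ := Finset.subset_map_iff.1 (Finset.mem_powerset.1 hb)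
      exact ⟨t, Finset.mem_univ _, rfl⟩
    · intros; rfl
  have hu : (Finset.univ : Finset (Finset (Fin (n+1)))) =
      (insert 0 ((Finset.univ : Finset (Fin n)).map (Fin.succEmb n))).powerset := by
    ext s
    simp only [Finset.mem_univ, Finset.mem_powerset, true_iff]
    intro i _
    refine Fin.cases ?_ (fun j => ?_) i <;> simp
  rw [hu, Finset.sum_powerset_insert h0, key, key (fun s => F (insert 0 s)),
    Finset.sum_add_distrib]

theorem pds_map {n : ℕ} (t : Finset (Fin n)) (f : (Fin (n+1) → ℝ) → ℂ) :
    partialDerivSet (t.map (Fin.succEmb n)) f = pdList (t.sort.map Fin.succ) f := by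
  have := Finset.map_sort (Fin.succEmb n) t (· ≤ ·) (· ≤ ·) (by simp)
  unfold partialDerivSet
  rw [← this]
  rfl

theorem pds_insert {n : ℕ} (t : Finset (Fin n)) (f : (Fin (n+1) → ℝ) → ℂ) :
    partialDerivSet (insert 0 (t.map (Fin.succEmb n))) f =
      fun x => fderiv ℝ (pdList (t.sort.map Fin.succ) f) x (Pi.single 0 1) := by
  rw [← pds_map]
  unfold partialDerivSet
  rw [Finset.sort_insert _ (by simp) (by simp)]
  rfl

theorem one_dim (g g' : ℝ → ℂ) (hg : ∀ x, HasDerivAt g (g' x) x) (hg' : Continuous g') :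
    ‖g 0‖ ≤ ∫ u in Set.Icc (0:ℝ) 1, (‖g u‖ + ‖g' u‖) := by
  have hgc : Continuous g := continuous_iff_continuousAt.2 fun x => (hg x).continuousAt
  set C := ∫ u in Set.Icc (0:ℝ) 1, ‖g' u‖ with hC
  have hi : IntegrableOn (fun u => ‖g' u‖) (Set.Icc (0:ℝ) 1) :=
    hg'.norm.continuousOn.integrableOn_Icc
  have hi2 : IntegrableOn (fun u => ‖g u‖) (Set.Icc (0:ℝ) 1) :=
    hgc.norm.continuousOn.integrableOn_Icc
  have pt : ∀ u ∈ Set.Icc (0:ℝ) 1, ‖g 0‖ - C ≤ ‖g u‖ := by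
    intro u hu
    have h1 : ∫ x in (0:ℝ)..u, g' x = g u - g 0 :=
      intervalIntegral.integral_eq_sub_of_hasDerivAt (fun x _ => hg x)
        (hg'.intervalIntegrable _ _)
    have h2 : ‖∫ x in (0:ℝ)..u, g' x‖ ≤ C := by
      refine (intervalIntegral.norm_integral_le_integral_norm hu.1).trans ?_
      rw [intervalIntegral.integral_of_le hu.1]
      exact setIntegral_mono_set hi (Filter.Eventually.of_forall fun x => norm_nonneg _)
        (Filter.Eventually.of_forall fun x hx => ⟨hx.1.le, hx.2.trans hu.2⟩)
    have h3 : g 0 = g u - ∫ x in (0:ℝ)..u, g' x := by rw [h1]; ring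
    have h4 := norm_sub_le (g u) (∫ x in (0:ℝ)..u, g' x)
    rw [← h3] at h4
    linarith
  have := setIntegral_mono_on (μ := volume) (s := Set.Icc (0:ℝ) 1) (f := fun _ => ‖g 0‖ - C)
    (by simp) hi2 measurableSet_Icc pt
  rw [integral_add hi2 hi]
  simp at this
  linarith

theorem fubini_cons {n : ℕ} (h : (Fin (n+1) → ℝ) → ℝ) (hc : Continuous h) :
    IntegrableOn (fun y : Fin n → ℝ => ∫ u in Set.Icc (0:ℝ) 1, h (Fin.cons u y))
      (Set.Icc 0 1) ∧
    ∫ x in Set.Icc (0 : Fin (n+1) → ℝ) 1, h x =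
      ∫ y in Set.Icc (0 : Fin n → ℝ) 1, ∫ u in Set.Icc (0:ℝ) 1, h (Fin.cons u y) := by
  have mp := (volume_preserving_piFinSuccAbove (fun _ : Fin (n + 1) => ℝ) 0).symm
  have e1 : ∀ p : ℝ × (Fin n → ℝ),
      (MeasurableEquiv.piFinSuccAbove (fun _ : Fin (n + 1) => ℝ) 0).symm p
        = (Fin.cons p.1 p.2 : Fin (n+1) → ℝ) := by
    intro p
    exact Fin.insertNth_zero' _ _
  have hcont : Continuous (fun p : ℝ × (Fin n → ℝ) => h (Fin.cons p.1 p.2)) := by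
    apply hc.comp
    fun_prop
  have hint : IntegrableOn (fun p : ℝ × (Fin n → ℝ) => h (Fin.cons p.1 p.2))
      (Set.Icc 0 1 ×ˢ Set.Icc 0 1) (volume.prod volume) :=
    hcont.continuousOn.integrableOn_compact (isCompact_Icc.prod isCompact_Icc)
  have pre : (MeasurableEquiv.piFinSuccAbove (fun _ : Fin (n + 1) => ℝ) 0).symm ⁻¹'
      (Set.Icc (0 : Fin (n+1) → ℝ) 1) = Set.Icc (0:ℝ) 1 ×ˢ Set.Icc (0 : Fin n → ℝ) 1 := by
    ext p
    rw [Set.mem_preimage, e1]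
    simp only [Set.mem_Icc, Set.mem_prod, Pi.le_def, Fin.forall_fin_succ, Fin.cons_zero,
      Fin.cons_succ, Pi.zero_apply, Pi.one_apply]
    tauto
  constructor
  · have := hint
    unfold IntegrableOn at this
    rw [← Measure.prod_restrict] at this
    exact this.integral_prod_right
  · rw [← mp.setIntegral_preimage_emb (MeasurableEquiv.measurableEmbedding _), pre]
    simp only [e1]
    rw [Measure.volume_eq_prod, ← setIntegral_prod_swap]
    exact setIntegral_prod _ hint.swap

/-- For a smooth function `f : ℝ^n → ℂ`,
`|f(0)| ≤ ∑_{I ⊆ {1,…,n}} ∫_{[0,1]^n} |∂^I f(x)| dx`. -/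
theorem stmt1 {n : ℕ} (f : (Fin n → ℝ) → ℂ) (hf : ContDiff ℝ (⊤ : ℕ∞) f) :
    ‖f 0‖ ≤ ∑ s : Finset (Fin n),
      ∫ x in Set.Icc (0 : Fin n → ℝ) 1, ‖partialDerivSet s f x‖ := by
  induction n with
  | zero =>
    have h1 : Set.Icc (0 : Fin 0 → ℝ) 1 = Set.univ := by
      ext x; simp [Pi.le_def]
    have h2 : ∀ (s : Finset (Fin 0)) x, partialDerivSet s f x = f 0 := by
      intro s x
      rw [Subsingleton.elim s ∅, Subsingleton.elim x 0]
      simp [partialDerivSet]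
    rw [h1]
    simp only [h2]
    simp [Measure.real, volume_pi]
  | succ n ih =>
    have h0 := ih (fun y => f (Fin.cons 0 y)) (hf.comp (contDiff_consv 0))
    have hz : (Fin.cons (0:ℝ) (0 : Fin n → ℝ) : Fin (n+1) → ℝ) = 0 := by
      ext j; refine Fin.cases ?_ (fun j => ?_) j <;> simp
    simp only [hz] at h0
    refine h0.trans ?_
    rw [sum_finset_succ]
    refine Finset.sum_le_sum fun t _ => ?_
    rw [pds_map, pds_insert]
    set g := pdList (t.sort.map Fin.succ) f with hg
    have hgs : ContDiff ℝ (⊤ : ℕ∞) g := pdList_contDiff _ _ hf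
    have hd : ContDiff ℝ (⊤ : ℕ∞) (fun x => fderiv ℝ g x (Pi.single 0 1)) :=
      pdList_contDiff (0 :: (t.sort (· ≤ ·)).map Fin.succ) _ hf
    have e : ∀ y, partialDerivSet t (fun y => f (Fin.cons 0 y)) y = g (Fin.cons 0 y) :=
      fun y => pdList_cons (t.sort (· ≤ ·)) f hf 0 y
    simp only [e]
    rw [← integral_add (hgs.continuous.norm.continuousOn.integrableOn_compact isCompact_Icc)
      (hd.continuous.norm.continuousOn.integrableOn_compact isCompact_Icc)]
    obtain ⟨hi, hF⟩ := fubini_cons (fun x => ‖g x‖ + ‖fderiv ℝ g x (Pi.single 0 1)‖)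
      (hgs.continuous.norm.add hd.continuous.norm)
    rw [hF]
    refine setIntegral_mono_on ?_ hi measurableSet_Icc fun y _ => ?_
    · exact ((hgs.comp (contDiff_consv 0)).continuous.norm).continuousOn.integrableOn_compact
        isCompact_Icc
    · refine one_dim (fun u => g (Fin.cons u y))
        (fun u => fderiv ℝ g (Fin.cons u y) (Pi.single 0 1)) (fun u => ?_) ?_
      · have hc : HasDerivAt (fun u : ℝ => (Fin.cons u y : Fin (n+1) → ℝ)) (Pi.single 0 1) u := by
          rw [hasDerivAt_pi]
          intro j
          refine Fin.cases ?_ (fun j => ?_) j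
          · simpa using hasDerivAt_id' u
          · simpa using hasDerivAt_const u (y j)
        exact ((hgs.differentiable (by simp)) _).hasFDerivAt.comp_hasDerivAt u hc
      · apply hd.continuous.comp
        fun_prop
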